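/- Let X be a finite (discrete) space on which the discrete group Γ acts, let ℓ be a proper length function on Γ⋉X, and suppose Γ⋉X has the rapid decay property with respect to ℓ and some p > 0. Let k > p be an integer. Let V denote C_c(Γ⋉X) equipped with the reduced norm ‖·‖_red, let K ⊆ V be the subspace { h ∈ C_c(Γ⋉X) : h(g,·) ≡ 0 for all g ≠ e }, and fix a continuous linear functional η on K. Let S_η = { μ in the continuous dual of V : ‖μ‖ = 1 and μ(h) = η(h) for all h ∈ K }, with ρ(μ,ν) = sup{ |μ(f) − ν(f)| : f ∈ C_c(Γ⋉X), L_ℓ^k(f) ≤ 1 }. Then the topology on S_η induced by the metric ρ coincides with the subspace topology inherited from the weak-* topology on the dual of V. -/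

import Mathlib

open scoped ENNReal

noncomputable section

variable {Γ X : Type*} [Group Γ] [TopologicalSpace X] [MulAction Γ X]

/-- `f ∈ C_c(Γ ⋉ X)` : each `f g : X → ℂ` is continuous, and `f g ≡ 0` for all but
finitely many `g ∈ Γ`. -/
def IsCc (f : Γ → X → ℂ) : Prop :=
  (∀ g : Γ, Continuous (f g)) ∧ {g : Γ | f g ≠ 0}.Finite

/-- Convolution: `(f ∗ ξ)(g, x) = Σ_{h ∈ Γ} f (g h⁻¹, h ⋅ x) ξ (h, x)`. -/
def convCc (f ξ : Γ → X → ℂ) : Γ → X → ℂ :=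
  fun g x => ∑ᶠ h : Γ, f (g * h⁻¹) (h • x) * ξ h x

/-- Involution: `f^*(g, x) = conj (f (g⁻¹, g ⋅ x))`. -/
def starCc (f : Γ → X → ℂ) : Γ → X → ℂ :=
  fun g x => (starRingEnd ℂ) (f g⁻¹ (g • x))

/-- Pointwise multiplication by the length function: `M_ℓ(f)(g,x) = ℓ(g,x) f(g,x)`. -/
def mulLen (ℓ : Γ → X → ℝ) (f : Γ → X → ℂ) : Γ → X → ℂ :=
  fun g x => (ℓ g x : ℂ) * f g x

/-- Iterated derivation: `Δ⁰(f)(ξ) = f ∗ ξ` and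
`Δ^k(f)(ξ) = M_ℓ(Δ^{k-1}(f)(ξ)) − Δ^{k-1}(f)(M_ℓ(ξ))`. -/
def deltaIter (ℓ : Γ → X → ℝ) (f : Γ → X → ℂ) : ℕ → (Γ → X → ℂ) → Γ → X → ℂ
  | 0, ξ => convCc f ξ
  | k + 1, ξ => mulLen ℓ (deltaIter ℓ f k ξ) - deltaIter ℓ f k (mulLen ℓ ξ)

/-- Hilbert-module norm: `‖ξ‖ = sup_{x ∈ X} (Σ_{g ∈ Γ} |ξ(g,x)|²)^{1/2}`. -/
def hnorm (ξ : Γ → X → ℂ) : ℝ :=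
  ⨆ x : X, Real.sqrt (∑ᶠ g : Γ, ‖ξ g x‖ ^ 2)

/-- The I-norm `‖f‖_I`. -/
def normI (f : Γ → X → ℂ) : ℝ :=
  max (⨆ x : X, ∑ᶠ g : Γ, ‖f g x‖) (⨆ x : X, ∑ᶠ g : Γ, ‖f g⁻¹ (g • x)‖)

/-- The `C(X)`-valued inner product: `⟨⟨ξ, η⟩⟩(x) = Σ_{g ∈ Γ} conj(ξ(g,x)) η(g,x)`. -/
def innerCc (ξ η : Γ → X → ℂ) (x : X) : ℂ :=
  ∑ᶠ g : Γ, (starRingEnd ℂ) (ξ g x) * η g x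

/-- Reduced norm: `‖f‖_red = sup { ‖f ∗ ξ‖ : ξ ∈ C_c, ‖ξ‖ ≤ 1 }`. -/
def redNorm (f : Γ → X → ℂ) : ℝ :=
  sSup {r : ℝ | ∃ ξ : Γ → X → ℂ, IsCc ξ ∧ hnorm ξ ≤ 1 ∧ r = hnorm (convCc f ξ)}

/-- The quasi-seminorm `L_ℓ^k(f) = sup { ‖Δ^k(f)(ξ)‖ : ξ ∈ C_c, ‖ξ‖ ≤ 1 }`. -/
def lipK (ℓ : Γ → X → ℝ) (k : ℕ) (f : Γ → X → ℂ) : ℝ :=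
  sSup {r : ℝ | ∃ ξ : Γ → X → ℂ, IsCc ξ ∧ hnorm ξ ≤ 1 ∧ r = hnorm (deltaIter ℓ f k ξ)}

/-- `‖f‖_{2,p,s,ℓ}`. -/
def norm2s (ℓ : Γ → X → ℝ) (p : ℝ) (f : Γ → X → ℂ) : ℝ :=
  ⨆ x : X, Real.sqrt (∑ᶠ g : Γ, ‖f g x‖ ^ 2 * (1 + ℓ g x) ^ (2 * p))

/-- `‖f‖_{2,p,r,ℓ}`. -/
def norm2r (ℓ : Γ → X → ℝ) (p : ℝ) (f : Γ → X → ℂ) : ℝ :=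
  ⨆ x : X, Real.sqrt (∑ᶠ g : Γ, ‖f g⁻¹ (g • x)‖ ^ 2 * (1 + ℓ g x) ^ (2 * p))

/-- `‖f‖_{2,p,ℓ} = max (‖f‖_{2,p,s,ℓ}, ‖f‖_{2,p,r,ℓ})`. -/
def norm2 (ℓ : Γ → X → ℝ) (p : ℝ) (f : Γ → X → ℂ) : ℝ :=
  max (norm2s ℓ p f) (norm2r ℓ p f)

/-- A length function on the transformation groupoid `Γ ⋉ X`. -/
def IsLength (ℓ : Γ → X → ℝ) : Prop :=
  (∀ g : Γ, Continuous (ℓ g)) ∧ (∀ (g : Γ) (x : X), 0 ≤ ℓ g x) ∧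
    (∀ (g : Γ) (x : X), ℓ g x = 0 ↔ g = 1) ∧
    (∀ (g : Γ) (x : X), ℓ g⁻¹ (g • x) = ℓ g x) ∧
    (∀ (g h : Γ) (x : X), ℓ (g * h) x ≤ ℓ g (h • x) + ℓ h x)

/-- Properness: for every `R ≥ 0`, only finitely many non-identity `g` satisfy
`ℓ(g, x) ≤ R` for some `x`. -/
def IsProperLen (ℓ : Γ → X → ℝ) : Prop :=
  ∀ R : ℝ, {g : Γ | g ≠ 1 ∧ ∃ x : X, ℓ g x ≤ R}.Finite

set_option linter.unusedSectionVars false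

theorem isCc_of_finite [DiscreteTopology X] {f : Γ → X → ℂ} (hf : (Function.support f).Finite) :
    IsCc f :=
  ⟨fun _ => continuous_of_discreteTopology, hf⟩

theorem IsCc.finite_support_apply {f : Γ → X → ℂ} (hf : IsCc f) (x : X) :
    (Function.support fun g => f g x).Finite :=
  hf.2.subset fun g hg h => hg (by simp [h])

theorem IsCc.mulLen [DiscreteTopology X] {ξ : Γ → X → ℂ} (hξ : IsCc ξ) (ℓ : Γ → X → ℝ) :
    IsCc (mulLen ℓ ξ) := by
  refine isCc_of_finite (hξ.2.subset fun g hg h => hg ?_)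
  funext x
  simp [_root_.mulLen, h]

theorem IsCc.indicator [DiscreteTopology X] {f : Γ → X → ℂ} (hf : IsCc f) (B : Set Γ) :
    IsCc (B.indicator f) :=
  isCc_of_finite (hf.2.subset (by rw [Set.support_indicator]; exact Set.inter_subset_right))

theorem finsum_le_finsum_of_nonneg {ι : Type*} {a b : ι → ℝ} (ha : ∀ i, 0 ≤ a i)
    (hab : ∀ i, a i ≤ b i) (hb : (Function.support b).Finite) : ∑ᶠ i, a i ≤ ∑ᶠ i, b i := by
  have hsub : Function.support a ⊆ hb.toFinset := by
    intro i hi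
    rw [Set.Finite.coe_toFinset]
    intro h
    exact hi (le_antisymm (h ▸ hab i) (ha i))
  rw [finsum_eq_sum_of_support_subset a hsub,
    finsum_eq_sum_of_support_subset b (s := hb.toFinset) (by simp)]
  exact Finset.sum_le_sum fun i _ => hab i

theorem hnorm_nonneg (ξ : Γ → X → ℂ) : 0 ≤ hnorm ξ :=
  Real.iSup_nonneg fun _ => Real.sqrt_nonneg _

theorem finsum_sq_le_hnorm_sq [Finite X] (ξ : Γ → X → ℂ) (x : X) :
    ∑ᶠ g : Γ, ‖ξ g x‖ ^ 2 ≤ hnorm ξ ^ 2 :=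
  (Real.sqrt_le_left (hnorm_nonneg ξ)).1
    (le_ciSup (f := fun x : X => Real.sqrt (∑ᶠ g : Γ, ‖ξ g x‖ ^ 2))
      (Set.finite_range _).bddAbove x)

theorem hnorm_le_of_forall_finsum_sq_le {ξ : Γ → X → ℂ} {c : ℝ} (hc : 0 ≤ c)
    (h : ∀ x, ∑ᶠ g : Γ, ‖ξ g x‖ ^ 2 ≤ c ^ 2) : hnorm ξ ≤ c :=
  Real.iSup_le (fun x => (Real.sqrt_le_left hc).2 (h x)) hc

theorem hnorm_smul (c : ℂ) (ξ : Γ → X → ℂ) : hnorm (c • ξ) = ‖c‖ * hnorm ξ := by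
  unfold hnorm
  rw [Real.mul_iSup_of_nonneg (norm_nonneg c)]
  congr 1
  funext x
  have : ∀ g, ‖(c • ξ) g x‖ ^ 2 = ‖c‖ ^ 2 • ‖ξ g x‖ ^ 2 := fun g => by
    simp [mul_pow]
  simp only [this]
  rw [← smul_finsum, smul_eq_mul, Real.sqrt_mul (by positivity), Real.sqrt_sq (norm_nonneg c)]

theorem deltaIter_smul (ℓ : Γ → X → ℝ) (c : ℂ) (f : Γ → X → ℂ) (k : ℕ) (ξ : Γ → X → ℂ) :
    deltaIter ℓ (c • f) k ξ = c • deltaIter ℓ f k ξ := by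
  induction k generalizing ξ with
  | zero =>
    funext g x
    simp only [deltaIter, convCc, Pi.smul_apply, smul_finsum]
    simp [mul_assoc]
  | succ k ih =>
    simp only [deltaIter, ih]
    funext g x
    simp only [mulLen, Pi.sub_apply, Pi.smul_apply, smul_eq_mul]
    ring

theorem lipK_smul (ℓ : Γ → X → ℝ) (k : ℕ) (c : ℂ) (f : Γ → X → ℂ) :
    lipK ℓ k (c • f) = ‖c‖ * lipK ℓ k f := by
  unfold lipK
  rw [← smul_eq_mul, ← Real.sSup_smul_of_nonneg (norm_nonneg c)]
  congr 1
  ext r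
  simp only [deltaIter_smul, hnorm_smul, Set.mem_smul_set, Set.mem_ofPred_eq, smul_eq_mul]
  constructor
  · rintro ⟨ξ, h1, h2, rfl⟩
    exact ⟨_, ⟨ξ, h1, h2, rfl⟩, rfl⟩
  · rintro ⟨_, ⟨ξ, h1, h2, rfl⟩, rfl⟩
    exact ⟨ξ, h1, h2, rfl⟩

theorem lipK_nonneg (ℓ : Γ → X → ℝ) (k : ℕ) (f : Γ → X → ℂ) : 0 ≤ lipK ℓ k f := by
  refine Real.sSup_nonneg ?_
  rintro _ ⟨ξ, -, -, rfl⟩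
  exact hnorm_nonneg _

/-- The kernel of `Δ^k(f)`. -/
theorem deltaIter_apply [DiscreteTopology X] (ℓ : Γ → X → ℝ) (f : Γ → X → ℂ) (k : ℕ)
    {ξ : Γ → X → ℂ} (hξ : IsCc ξ) (g : Γ) (x : X) :
    deltaIter ℓ f k ξ g x =
      ∑ᶠ h : Γ, ((ℓ g x : ℂ) - ℓ h x) ^ k * f (g * h⁻¹) (h • x) * ξ h x := by
  induction k generalizing ξ with
  | zero => simp [deltaIter, convCc]
  | succ k ih =>
    have hfin : ∀ (a b : Γ → ℂ),
        (Function.support fun h : Γ => a h * (b h * ξ h x)).Finite := fun a b =>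
      (hξ.finite_support_apply x).subset fun h hh h0 => hh (by
        have : ξ h x = 0 := h0
        simp [this])
    simp only [deltaIter, Pi.sub_apply]
    rw [mulLen, ih hξ, ih (hξ.mulLen ℓ), mul_finsum, ← finsum_sub_distrib]
    · refine finsum_congr fun h => ?_
      simp only [mulLen]
      ring
    · refine (hfin (fun _ => (ℓ g x : ℂ)) _).subset subset_rfl
    · refine (hfin (fun h => ((ℓ g x : ℂ) - ℓ h x) ^ k * f (g * h⁻¹) (h • x))
        (fun h => (ℓ h x : ℂ))).subset subset_rfl

theorem IsLength.abs_sub_le {ℓ : Γ → X → ℝ} (hℓ : IsLength ℓ) (s g : Γ) (x : X) :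
    |ℓ g x - ℓ (s⁻¹ * g) x| ≤ ℓ s ((s⁻¹ * g) • x) := by
  obtain ⟨-, -, -, hinv, htri⟩ := hℓ
  have h1 := htri s (s⁻¹ * g) x
  have h2 := htri s⁻¹ g x
  have h3 := hinv s ((s⁻¹ * g) • x)
  rw [smul_smul, mul_inv_cancel_left] at h3
  rw [mul_inv_cancel_left] at h1
  rw [abs_le]
  constructor <;> linarith

theorem exists_norm_sq_deltaIter_le [Finite X] [DiscreteTopology X] {ℓ : Γ → X → ℝ}
    (hℓ : IsLength ℓ) (k : ℕ) {f : Γ → X → ℂ} (hf : IsCc f) :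
    ∃ (K : ℝ) (T : Finset Γ), 0 ≤ K ∧ ∀ ξ : Γ → X → ℂ, IsCc ξ → ∀ g x,
      ‖deltaIter ℓ f k ξ g x‖ ^ 2 ≤ K * ∑ s ∈ T, ‖ξ (s⁻¹ * g) x‖ ^ 2 := by
  classical
  have := Fintype.ofFinite X
  set T : Finset Γ := hf.2.toFinset with hT
  set M : ℝ := ∑ s ∈ T, ∑ y : X, ℓ s y ^ k * ‖f s y‖ with hM
  have hℓ0 := hℓ.2.1
  have hterm0 : ∀ s y, 0 ≤ ℓ s y ^ k * ‖f s y‖ := fun s y =>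
    mul_nonneg (pow_nonneg (hℓ0 s y) k) (norm_nonneg _)
  have hM0 : 0 ≤ M := Finset.sum_nonneg fun s _ => Finset.sum_nonneg fun y _ => hterm0 s y
  have hle : ∀ s ∈ T, ∀ y, ℓ s y ^ k * ‖f s y‖ ≤ M := fun s hs y =>
    (Finset.single_le_sum (f := fun y => ℓ s y ^ k * ‖f s y‖) (fun y _ => hterm0 s y)
      (Finset.mem_univ y)).trans
    (Finset.single_le_sum (f := fun s => ∑ y : X, ℓ s y ^ k * ‖f s y‖)
      (fun s _ => Finset.sum_nonneg fun y _ => hterm0 s y) hs)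
  refine ⟨T.card * M ^ 2, T, by positivity, fun ξ hξ g x => ?_⟩
  have hsum : deltaIter ℓ f k ξ g x = ∑ s ∈ T,
      ((ℓ g x : ℂ) - ℓ (s⁻¹ * g) x) ^ k * f s ((s⁻¹ * g) • x) * ξ (s⁻¹ * g) x := by
    rw [deltaIter_apply ℓ f k hξ,
      ← finsum_comp_equiv ((Equiv.inv Γ).trans (Equiv.mulRight g))]
    simp only [Equiv.trans_apply, Equiv.inv_apply, Equiv.coe_mulRight, mul_inv_rev, inv_inv,
      mul_inv_cancel_left]
    refine finsum_eq_sum_of_support_subset _ fun s hs => ?_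
    simp only [hT, Set.Finite.coe_toFinset, Set.mem_ofPred_eq]
    intro h
    exact hs (by simp [h])
  have hbound : ‖deltaIter ℓ f k ξ g x‖ ≤ ∑ s ∈ T, M * ‖ξ (s⁻¹ * g) x‖ := by
    rw [hsum]
    refine (norm_sum_le _ _).trans (Finset.sum_le_sum fun s hs => ?_)
    rw [norm_mul, norm_mul, norm_pow, ← Complex.ofReal_sub, Complex.norm_real, Real.norm_eq_abs]
    refine mul_le_mul_of_nonneg_right (le_trans ?_ (hle s hs ((s⁻¹ * g) • x))) (norm_nonneg _)
    gcongr
    exact hℓ.abs_sub_le s g x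
  calc ‖deltaIter ℓ f k ξ g x‖ ^ 2 ≤ (∑ s ∈ T, M * ‖ξ (s⁻¹ * g) x‖) ^ 2 := by gcongr
    _ ≤ T.card * ∑ s ∈ T, (M * ‖ξ (s⁻¹ * g) x‖) ^ 2 := sq_sum_le_card_mul_sum_sq
    _ = _ := by simp only [mul_pow, ← Finset.mul_sum]; ring

theorem finite_support_sum_translate {ξ : Γ → X → ℂ} (hξ : IsCc ξ) (x : X) (K : ℝ)
    (T : Finset Γ) :
    (Function.support fun g => K * ∑ s ∈ T, ‖ξ (s⁻¹ * g) x‖ ^ 2).Finite := by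
  refine (Set.Finite.biUnion T.finite_toSet fun s _ =>
    (hξ.finite_support_apply x).image (s * ·)).subset fun g hg => ?_
  obtain ⟨s, hs, h⟩ := Finset.exists_ne_zero_of_sum_ne_zero (right_ne_zero_of_mul hg)
  refine Set.mem_biUnion hs ⟨s⁻¹ * g, fun h0 => h ?_, by simp⟩
  have : ξ (s⁻¹ * g) x = 0 := h0
  simp [this]

theorem bddAbove_hnorm_deltaIter [Finite X] [DiscreteTopology X] {ℓ : Γ → X → ℝ}
    (hℓ : IsLength ℓ) (k : ℕ) {f : Γ → X → ℂ} (hf : IsCc f) :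
    BddAbove {r : ℝ | ∃ ξ : Γ → X → ℂ, IsCc ξ ∧ hnorm ξ ≤ 1 ∧
      r = hnorm (deltaIter ℓ f k ξ)} := by
  obtain ⟨K, T, hK, h⟩ := exists_norm_sq_deltaIter_le hℓ k hf
  refine ⟨Real.sqrt (K * T.card), ?_⟩
  rintro _ ⟨ξ, hξ, hξ1, rfl⟩
  refine hnorm_le_of_forall_finsum_sq_le (Real.sqrt_nonneg _) fun x => ?_
  have hξx : ∑ᶠ g : Γ, ‖ξ g x‖ ^ 2 ≤ 1 :=
    (finsum_sq_le_hnorm_sq ξ x).trans (pow_le_one₀ (hnorm_nonneg ξ) hξ1)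
  have htr : ∀ s : Γ, (Function.support fun g => ‖ξ (s⁻¹ * g) x‖ ^ 2).Finite := fun s => by
    simpa using finite_support_sum_translate hξ x 1 {s}
  have hcomp : ∀ s : Γ, ∑ᶠ g : Γ, ‖ξ (s⁻¹ * g) x‖ ^ 2 = ∑ᶠ g : Γ, ‖ξ g x‖ ^ 2 := fun s =>
    finsum_comp_equiv (Equiv.mulLeft s⁻¹) (f := fun g => ‖ξ g x‖ ^ 2)
  calc ∑ᶠ g : Γ, ‖deltaIter ℓ f k ξ g x‖ ^ 2
      ≤ ∑ᶠ g : Γ, K * ∑ s ∈ T, ‖ξ (s⁻¹ * g) x‖ ^ 2 :=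
        finsum_le_finsum_of_nonneg (fun _ => by positivity) (fun g => h ξ hξ g x)
          (finite_support_sum_translate hξ x K T)
    _ = K * ∑ s ∈ T, ∑ᶠ g : Γ, ‖ξ (s⁻¹ * g) x‖ ^ 2 := by
        rw [← finsum_sum_comm _ _ fun s _ => htr s, ← smul_eq_mul, smul_finsum]
        simp only [smul_eq_mul]
    _ ≤ Real.sqrt (K * T.card) ^ 2 := by
        rw [Real.sq_sqrt (by positivity)]
        simp only [hcomp, Finset.sum_const, nsmul_eq_mul]
        exact mul_le_mul_of_nonneg_left (mul_le_of_le_one_right (by positivity) hξx) hK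

theorem finsum_deltaIter_sq_le [Finite X] [DiscreteTopology X] {ℓ : Γ → X → ℝ}
    (hℓ : IsLength ℓ) {k : ℕ} {f : Γ → X → ℂ} (hf : IsCc f) (hL : lipK ℓ k f ≤ 1)
    {ξ : Γ → X → ℂ} (hξ : IsCc ξ) (hξ1 : hnorm ξ ≤ 1) (x : X) :
    ∑ᶠ g : Γ, ‖deltaIter ℓ f k ξ g x‖ ^ 2 ≤ 1 :=
  (finsum_sq_le_hnorm_sq _ x).trans (pow_le_one₀ (hnorm_nonneg _)
    ((le_csSup (bddAbove_hnorm_deltaIter hℓ k hf) ⟨ξ, hξ, hξ1, rfl⟩).trans hL))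

theorem norm_deltaIter_apply_sq_le [Finite X] [DiscreteTopology X] {ℓ : Γ → X → ℝ}
    (hℓ : IsLength ℓ) {k : ℕ} {f : Γ → X → ℂ} (hf : IsCc f) (hL : lipK ℓ k f ≤ 1)
    {ξ : Γ → X → ℂ} (hξ : IsCc ξ) (hξ1 : hnorm ξ ≤ 1) (g : Γ) (x : X) :
    ‖deltaIter ℓ f k ξ g x‖ ^ 2 ≤ 1 := by
  obtain ⟨K, T, hK, h⟩ := exists_norm_sq_deltaIter_le hℓ k hf
  refine le_trans (single_le_finsum (f := fun g => ‖deltaIter ℓ f k ξ g x‖ ^ 2) g ?_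
    fun _ => by positivity)
    (finsum_deltaIter_sq_le hℓ hf hL hξ hξ1 x)
  refine (finite_support_sum_translate hξ x K T).subset fun g' hg' h0 => hg' ?_
  have h0' : K * ∑ s ∈ T, ‖ξ (s⁻¹ * g') x‖ ^ 2 = 0 := h0
  exact le_antisymm (h0' ▸ h ξ hξ g' x) (by positivity)

/-- The column of `Δ^k(f)` at the unit is square summable with norm at most `L_ℓ^k(f)`. -/
theorem finsum_column_le_one [Finite X] [DiscreteTopology X] {ℓ : Γ → X → ℝ}
    (hℓ : IsLength ℓ) {k : ℕ} {f : Γ → X → ℂ} (hf : IsCc f) (hL : lipK ℓ k f ≤ 1) (x : X) :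
    ∑ᶠ g : Γ, ‖f g x‖ ^ 2 * ℓ g x ^ (2 * k) ≤ 1 := by
  classical
  set ξ : Γ → X → ℂ := Pi.single 1 1 with hξdef
  have hξ : IsCc ξ := isCc_of_finite ((Set.finite_singleton 1).subset Pi.support_single_subset)
  have hval : ∀ g x, g ≠ 1 → ξ g x = 0 := fun g x hg => by simp [hξdef, hg]
  have hξ1 : hnorm ξ ≤ 1 := by
    refine hnorm_le_of_forall_finsum_sq_le zero_le_one fun x => ?_
    rw [finsum_eq_single _ 1 fun g hg => by simp [hval g x hg]]
    simp [hξdef]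
  convert finsum_deltaIter_sq_le hℓ hf hL hξ hξ1 x using 3 with g
  rw [deltaIter_apply ℓ f k hξ, finsum_eq_single _ 1 fun g hg => by simp [hval g x hg],
    (hℓ.2.2.1 1 x).2 rfl]
  simp only [hξdef, Complex.ofReal_zero, sub_zero, inv_one, mul_one, one_smul, Pi.single_eq_same,
    Pi.one_apply, norm_mul, norm_pow, Complex.norm_real, Real.norm_eq_abs,
    abs_of_nonneg (hℓ.2.1 g x)]
  ring

theorem finite_support_row [DiscreteTopology X] {f : Γ → X → ℂ} (hf : IsCc f) (x : X)
    (a : Γ → ℝ) : (Function.support fun g => ‖f g⁻¹ (g • x)‖ ^ 2 * a g).Finite := by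
  refine (hf.2.preimage (inv_injective.injOn)).subset fun g hg h => hg ?_
  have : f g⁻¹ = 0 := h
  simp [this]

/-- The row of `Δ^k(f)` at the unit is square summable with norm at most `L_ℓ^k(f)`. -/
theorem finsum_row_le_one [Finite X] [DiscreteTopology X] {ℓ : Γ → X → ℝ}
    (hℓ : IsLength ℓ) {k : ℕ} {f : Γ → X → ℂ} (hf : IsCc f) (hL : lipK ℓ k f ≤ 1) (x : X) :
    ∑ᶠ g : Γ, ‖f g⁻¹ (g • x)‖ ^ 2 * ℓ g x ^ (2 * k) ≤ 1 := by
  classical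
  set A : ℝ := ∑ᶠ g : Γ, ‖f g⁻¹ (g • x)‖ ^ 2 * ℓ g x ^ (2 * k) with hA
  by_contra! hA1
  have hA0 : 0 < A := zero_lt_one.trans hA1
  set v : Γ → ℂ := fun h => (-(ℓ h x : ℂ)) ^ k * f h⁻¹ (h • x) with hv
  have hvsq : ∀ h, ‖v h‖ ^ 2 = ‖f h⁻¹ (h • x)‖ ^ 2 * ℓ h x ^ (2 * k) := fun h => by
    simp only [hv, norm_mul, norm_pow, norm_neg, Complex.norm_real, Real.norm_eq_abs,
      abs_of_nonneg (hℓ.2.1 h x)]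
    ring
  set c : ℂ := (((Real.sqrt A)⁻¹ : ℝ) : ℂ) with hc
  have hcn : ‖c‖ ^ 2 = A⁻¹ := by
    rw [hc, Complex.norm_real, Real.norm_eq_abs, sq_abs, inv_pow, Real.sq_sqrt hA0.le]
  set ξ : Γ → X → ℂ := fun h => Pi.single x (c * starRingEnd ℂ (v h)) with hξdef
  have hξ : IsCc ξ := by
    refine isCc_of_finite ((hf.2.preimage inv_injective.injOn).subset fun g hg h => hg ?_)
    have : f g⁻¹ = 0 := h
    simp [hξdef, hv, this]
  have hξ1 : hnorm ξ ≤ 1 := by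
    refine hnorm_le_of_forall_finsum_sq_le zero_le_one fun y => ?_
    by_cases hy : y = x
    · subst hy
      have : ∀ g, ‖ξ g y‖ ^ 2 = A⁻¹ • (‖f g⁻¹ (g • y)‖ ^ 2 * ℓ g y ^ (2 * k)) := fun g => by
        rw [← hvsq, ← hcn]
        simp [hξdef, mul_pow]
      simp only [this]
      rw [← smul_finsum, ← hA, smul_eq_mul, inv_mul_cancel₀ hA0.ne']
      norm_num
    · simp [hξdef, hy]
  have hval : deltaIter ℓ f k ξ 1 x = c * (A : ℂ) := by
    rw [deltaIter_apply ℓ f k hξ, hA, (hℓ.2.2.1 1 x).2 rfl]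
    have hfs := finite_support_row hf x fun g => ℓ g x ^ (2 * k)
    have hcast : ((∑ᶠ g : Γ, ‖f g⁻¹ (g • x)‖ ^ 2 * ℓ g x ^ (2 * k) : ℝ) : ℂ) =
        ∑ᶠ g : Γ, ((‖f g⁻¹ (g • x)‖ ^ 2 * ℓ g x ^ (2 * k) : ℝ) : ℂ) :=
      map_finsum Complex.ofRealHom hfs
    rw [hcast, ← smul_eq_mul, smul_finsum]
    refine finsum_congr fun h => ?_
    rw [← hvsq, Complex.ofReal_pow, ← Complex.mul_conj']
    simp only [hξdef, hv, Complex.ofReal_zero, zero_sub, one_mul, Pi.single_eq_same, smul_eq_mul]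
    ring
  have h := norm_deltaIter_apply_sq_le hℓ hf hL hξ hξ1 1 x
  rw [hval, norm_mul, mul_pow, hcn, Complex.norm_real, Real.norm_eq_abs, sq_abs] at h
  have : A⁻¹ * A ^ 2 = A := by field_simp
  linarith

/-- Polynomials of degree `p < k` are eventually small compared with `t ^ k`. -/
theorem exists_one_add_rpow_le {p : ℝ} {k : ℕ} (hk : p < k) {τ : ℝ} (hτ : 0 < τ) :
    ∃ R : ℝ, 0 < R ∧ ∀ t, R < t → (1 + t) ^ (2 * p) ≤ τ ^ 2 * t ^ (2 * k) := by
  have h1 : Filter.Tendsto (fun t : ℝ => (1 + t) ^ (-(2 * (k - p)))) Filter.atTop (nhds 0) :=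
    (tendsto_rpow_neg_atTop (by linarith)).comp
      (Filter.tendsto_atTop_add_const_left _ 1 Filter.tendsto_id)
  have hc : 0 < τ ^ 2 / 2 ^ (2 * k) := by positivity
  obtain ⟨R, hR⟩ := Filter.eventually_atTop.1 (h1.eventually_lt_const hc)
  refine ⟨max R 1, by positivity, fun t ht => ?_⟩
  have ht1 : 1 < t := (le_max_right R 1).trans_lt ht
  have hlt := (hR t ((le_max_left R 1).trans ht.le)).le
  have h0 : 0 < 1 + t := by linarith
  calc (1 + t) ^ (2 * p) = (1 + t) ^ (-(2 * (k - p))) * (1 + t) ^ (2 * k) := by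
        rw [← Real.rpow_natCast, ← Real.rpow_add h0]
        congr 1
        push_cast
        ring
    _ ≤ τ ^ 2 / 2 ^ (2 * k) * (2 * t) ^ (2 * k) := by
        gcongr
        linarith
    _ = τ ^ 2 * t ^ (2 * k) := by
        rw [mul_pow]
        field_simp

theorem norm2_indicator_le [Finite X] [DiscreteTopology X] {ℓ : Γ → X → ℝ}
    (hℓ : IsLength ℓ) {p : ℝ} {k : ℕ} {f : Γ → X → ℂ} (hf : IsCc f) (hL : lipK ℓ k f ≤ 1)
    {τ : ℝ} (hτ : 0 < τ) {B : Set Γ}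
    (hB : ∀ g ∈ B, ∀ x, (1 + ℓ g x) ^ (2 * p) ≤ τ ^ 2 * ℓ g x ^ (2 * k)) :
    norm2 ℓ p (B.indicator f) ≤ τ := by
  classical
  have hpos : ∀ (q : ℝ) (g : Γ) (x : X), 0 ≤ (1 + ℓ g x) ^ q := fun q g x =>
    Real.rpow_nonneg (by linarith [hℓ.2.1 g x]) q
  have hpow : ∀ (g : Γ) (x : X), 0 ≤ ℓ g x ^ (2 * k) := fun g x => pow_nonneg (hℓ.2.1 g x) _
  have key : ∀ (a : ℝ) (g : Γ) (x : X),
      (1 + ℓ g x) ^ (2 * p) ≤ τ ^ 2 * ℓ g x ^ (2 * k) →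
      a ^ 2 * (1 + ℓ g x) ^ (2 * p) ≤ τ ^ 2 • (a ^ 2 * ℓ g x ^ (2 * k)) := fun a g x h =>
    (mul_le_mul_of_nonneg_left h (sq_nonneg a)).trans_eq (by rw [smul_eq_mul]; ring)
  refine max_le (Real.iSup_le (fun x => (Real.sqrt_le_left hτ.le).2 ?_) hτ.le)
    (Real.iSup_le (fun x => (Real.sqrt_le_left hτ.le).2 ?_) hτ.le)
  · calc _ ≤ ∑ᶠ g, τ ^ 2 • (‖f g x‖ ^ 2 * ℓ g x ^ (2 * k)) := by
          refine finsum_le_finsum_of_nonneg (fun g => mul_nonneg (sq_nonneg _) (hpos _ g x))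
            (fun g => ?_) ((hf.finite_support_apply x).subset fun g hg h => hg ?_)
          · by_cases hg : g ∈ B
            · rw [Set.indicator_of_mem hg]
              exact key _ g x (hB g hg x)
            · rw [Set.indicator_of_notMem hg]
              simpa using mul_nonneg (sq_nonneg τ) (mul_nonneg (sq_nonneg ‖f g x‖) (hpow g x))
          · have : f g x = 0 := h
            simp [this]
      _ ≤ τ ^ 2 := by
          rw [← smul_finsum, smul_eq_mul]
          exact mul_le_of_le_one_right (sq_nonneg τ) (finsum_column_le_one hℓ hf hL x)
  · calc _ ≤ ∑ᶠ g, τ ^ 2 • (‖f g⁻¹ (g • x)‖ ^ 2 * ℓ g x ^ (2 * k)) := by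
          refine finsum_le_finsum_of_nonneg (fun g => mul_nonneg (sq_nonneg _) (hpos _ g x))
            (fun g => ?_) ((finite_support_row hf x fun g => ℓ g x ^ (2 * k)).subset
              fun g hg h => hg ?_)
          · by_cases hg : g⁻¹ ∈ B
            · rw [Set.indicator_of_mem hg]
              refine key _ g x ?_
              simpa only [hℓ.2.2.2.1] using hB g⁻¹ hg (g • x)
            · rw [Set.indicator_of_notMem hg]
              simpa using mul_nonneg (sq_nonneg τ)
                (mul_nonneg (sq_nonneg ‖f g⁻¹ (g • x)‖) (hpow g x))
          · have h' : ‖f g⁻¹ (g • x)‖ ^ 2 * ℓ g x ^ (2 * k) = 0 := h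
            simp only [h', smul_zero]
      _ ≤ τ ^ 2 := by
          rw [← smul_finsum, smul_eq_mul]
          exact mul_le_of_le_one_right (sq_nonneg τ) (finsum_row_le_one hℓ hf hL x)

theorem norm_apply_le_inv_pow [Finite X] [DiscreteTopology X] {ℓ : Γ → X → ℝ}
    (hℓ : IsLength ℓ) {k : ℕ} {f : Γ → X → ℂ} (hf : IsCc f) (hL : lipK ℓ k f ≤ 1)
    {g : Γ} (hg : g ≠ 1) (x : X) : ‖f g x‖ ≤ (ℓ g x ^ k)⁻¹ := by
  have hpos : 0 < ℓ g x := lt_of_le_of_ne (hℓ.2.1 g x) fun h => hg ((hℓ.2.2.1 g x).1 h.symm)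
  have h : ‖f g x‖ ^ 2 * ℓ g x ^ (2 * k) ≤ 1 := by
    refine le_trans (single_le_finsum (f := fun g => ‖f g x‖ ^ 2 * ℓ g x ^ (2 * k)) g ?_
      fun g' => mul_nonneg (sq_nonneg _) (pow_nonneg (hℓ.2.1 g' x) _))
      (finsum_column_le_one hℓ hf hL x)
    refine (hf.finite_support_apply x).subset fun g' hg' h0 => hg' ?_
    have : f g' x = 0 := h0
    simp [this]
  rw [← one_div, le_div_iff₀ (pow_pos hpos k)]
  refine (sq_le_one_iff₀ (by positivity)).1 ?_
  rwa [mul_pow, ← pow_mul, mul_comm k 2]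


/-- for `X` finite (discrete) with rapid decay, on each fibre `S_η` the
topology of the metric `ρ(μ,ν) = sup { |μ(f) − ν(f)| : L_ℓ^k(f) ≤ 1 }` coincides with
the weak-* topology (topology of pointwise convergence on `C_c(Γ⋉X)`), expressed via
the coincidence of the canonical neighbourhood bases of the two topologies. -/
theorem stmt_16 [Finite X] [DiscreteTopology X]
    (ℓ : Γ → X → ℝ) (hℓ : IsLength ℓ) (hprop : IsProperLen ℓ)
    (p C : ℝ) (hp : 0 < p) (hC : 0 < C)
    (hRD : ∀ f : Γ → X → ℂ, IsCc f → redNorm f ≤ C * norm2 ℓ p f)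
    (k : ℕ) (hk : p < (k : ℝ))
    (η : (Γ → X → ℂ) →ₗ[ℂ] ℂ) (Cη : ℝ)
    (hη : ∀ h : Γ → X → ℂ, IsCc h → (∀ g : Γ, g ≠ 1 → h g = 0) → ‖η h‖ ≤ Cη * redNorm h)
    (S : Set ((Γ → X → ℂ) →ₗ[ℂ] ℂ))
    (hS : S = {μ : (Γ → X → ℂ) →ₗ[ℂ] ℂ |
      (∀ f : Γ → X → ℂ, IsCc f → ‖μ f‖ ≤ redNorm f) ∧
      sSup {r : ℝ | ∃ f : Γ → X → ℂ, IsCc f ∧ redNorm f ≤ 1 ∧ r = ‖μ f‖} = 1 ∧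
      (∀ h : Γ → X → ℂ, IsCc h → (∀ g : Γ, g ≠ 1 → h g = 0) → μ h = η h)})
    (ρ : ((Γ → X → ℂ) →ₗ[ℂ] ℂ) → ((Γ → X → ℂ) →ₗ[ℂ] ℂ) → ℝ≥0∞)
    (hρ : ∀ μ ν : (Γ → X → ℂ) →ₗ[ℂ] ℂ,
      ρ μ ν = ⨆ f : {f : Γ → X → ℂ // IsCc f ∧ lipK ℓ k f ≤ 1}, ENNReal.ofReal ‖μ f.1 - ν f.1‖) :
    ∀ μ ∈ S, ∀ V : Set ((Γ → X → ℂ) →ₗ[ℂ] ℂ),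
      (∃ ε : ℝ, 0 < ε ∧ {ν | ν ∈ S ∧ ρ μ ν < ENNReal.ofReal ε} ⊆ V) ↔
        (∃ F : Finset (Γ → X → ℂ), (∀ f ∈ F, IsCc f) ∧ ∃ ε : ℝ, 0 < ε ∧
          {ν | ν ∈ S ∧ ∀ f ∈ F, ‖μ f - ν f‖ < ε} ⊆ V) := by
  classical
  have := Fintype.ofFinite X
  intro μ hμ V
  constructor
  · rintro ⟨ε, hε, hV⟩
    set τ : ℝ := ε / (8 * C) with hτ
    have hτ0 : 0 < τ := by positivity
    obtain ⟨R, hR, hRt⟩ := exists_one_add_rpow_le hk hτ0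
    set B : Finset Γ := (hprop R).toFinset with hB
    have hBmem : ∀ g, g ∈ B ↔ g ≠ 1 ∧ ∃ x : X, ℓ g x ≤ R := fun g => by simp [hB]
    set M : ℝ := ∑ g ∈ B, ∑ x : X, (ℓ g x ^ k)⁻¹ with hM
    have hM0 : 0 ≤ M := Finset.sum_nonneg fun g _ => Finset.sum_nonneg fun x _ =>
      inv_nonneg.2 (pow_nonneg (hℓ.2.1 g x) k)
    set e : Γ → X → Γ → X → ℂ := fun g x => Pi.single g (Pi.single x 1) with he
    refine ⟨(B ×ˢ Finset.univ).image fun q : Γ × X => e q.1 q.2, ?_, ε / (4 * (M + 1)),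
      by positivity, fun ν hν => hV ⟨hν.1, ?_⟩⟩
    · intro f hf
      obtain ⟨q, -, rfl⟩ := Finset.mem_image.1 hf
      exact isCc_of_finite ((Set.finite_singleton q.1).subset Pi.support_single_subset)
    · refine lt_of_le_of_lt ?_ ((ENNReal.ofReal_lt_ofReal_iff hε).2 (half_lt_self hε))
      rw [hρ]
      refine iSup_le fun ⟨f, hf, hL⟩ => ENNReal.ofReal_le_ofReal ?_
      obtain ⟨hνS, hνF⟩ := hν
      rw [hS] at hμ hνS
      have hsplit : f = ({1} : Set Γ).indicator f + (∑ g ∈ B, ∑ x : X, f g x • e g x) +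
          ({g | g ≠ 1 ∧ g ∉ B} : Set Γ).indicator f := by
        funext g x
        have hmid : (∑ g ∈ B, ∑ x : X, f g x • e g x) g x = if g ∈ B then f g x else 0 := by
          simp [he, Finset.sum_apply, Pi.single_apply, ite_apply]
        simp only [Pi.add_apply, hmid]
        by_cases h1 : g = 1
        · have : (1 : Γ) ∉ B := fun h => ((hBmem 1).1 h).1 rfl
          simp [h1, this]
        · by_cases h2 : g ∈ B <;> simp [h1, h2]
      have hdiag : μ (({1} : Set Γ).indicator f) = ν (({1} : Set Γ).indicator f) := by
        have h1 : ∀ g : Γ, g ≠ 1 → ({1} : Set Γ).indicator f g = 0 := fun g hg =>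
          Set.indicator_of_notMem (by simpa using hg) f
        rw [hμ.2.2 _ (hf.indicator _) h1, hνS.2.2 _ (hf.indicator _) h1]
      set t := ({g | g ≠ 1 ∧ g ∉ B} : Set Γ).indicator f with ht
      have htail : redNorm t ≤ ε / 8 := by
        refine (hRD t (hf.indicator _)).trans ?_
        calc C * norm2 ℓ p t ≤ C * τ := by
              refine mul_le_mul_of_nonneg_left (norm2_indicator_le hℓ hf hL hτ0 ?_) hC.le
              intro g hg x
              refine hRt _ ?_
              by_contra! h
              exact hg.2 ((hBmem g).2 ⟨hg.1, x, h⟩)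
          _ = ε / 8 := by rw [hτ]; field_simp
      have hmid : ‖∑ g ∈ B, ∑ x : X, f g x * (μ (e g x) - ν (e g x))‖ ≤ ε / 4 := by
        calc _ ≤ ∑ g ∈ B, ∑ x : X, (ℓ g x ^ k)⁻¹ * (ε / (4 * (M + 1))) := by
              refine (norm_sum_le _ _).trans (Finset.sum_le_sum fun g hg =>
                (norm_sum_le _ _).trans (Finset.sum_le_sum fun x _ => ?_))
              rw [norm_mul]
              refine mul_le_mul (norm_apply_le_inv_pow hℓ hf hL ((hBmem g).1 hg).1 x)
                (hνF _ (Finset.mem_image.2 ⟨(g, x), by simpa using hg, rfl⟩)).le (norm_nonneg _)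
                (inv_nonneg.2 (pow_nonneg (hℓ.2.1 g x) k))
          _ = M * (ε / (4 * (M + 1))) := by simp only [← Finset.sum_mul, hM]
          _ ≤ ε / 4 := by
              rw [← mul_div_assoc, div_le_div_iff₀ (by positivity) (by positivity)]
              nlinarith
      have hdecomp : μ f - ν f =
          ∑ g ∈ B, ∑ x : X, f g x * (μ (e g x) - ν (e g x)) + (μ t - ν t) := by
        conv_lhs => rw [hsplit]
        simp only [map_add, map_sum, map_smul, smul_eq_mul, hdiag, mul_sub,
          Finset.sum_sub_distrib]
        ring
      have h1 := hμ.1 t (hf.indicator _)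
      have h2 := hνS.1 t (hf.indicator _)
      calc ‖μ f - ν f‖ ≤ ε / 4 + (ε / 8 + ε / 8) := by
            rw [hdecomp]
            refine (norm_add_le _ _).trans (add_le_add hmid ((norm_sub_le _ _).trans ?_))
            exact add_le_add (h1.trans htail) (h2.trans htail)
        _ = ε / 2 := by ring
  · rintro ⟨F, hF, ε, hε, hV⟩
    set N : ℝ := 1 + ∑ f ∈ F, lipK ℓ k f with hN
    have hN0 : 0 < N := by
      have := Finset.sum_nonneg fun f (_ : f ∈ F) => lipK_nonneg ℓ k f
      linarith
    refine ⟨ε / N, by positivity, fun ν hν => hV ⟨hν.1, fun f hf => ?_⟩⟩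
    have hfN : lipK ℓ k f ≤ N := by
      have := Finset.single_le_sum (fun f (_ : f ∈ F) => lipK_nonneg ℓ k f) hf
      linarith
    have hcn : ‖((N⁻¹ : ℝ) : ℂ)‖ = N⁻¹ := by
      rw [Complex.norm_real, Real.norm_eq_abs, abs_of_pos (inv_pos.2 hN0)]
    have hmem : IsCc (((N⁻¹ : ℝ) : ℂ) • f) ∧ lipK ℓ k (((N⁻¹ : ℝ) : ℂ) • f) ≤ 1 := by
      refine ⟨isCc_of_finite ((hF f hf).2.subset fun g hg h => hg (by simp [h])), ?_⟩
      rw [lipK_smul, hcn, inv_mul_le_iff₀ hN0, mul_one]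
      exact hfN
    have h := hν.2
    rw [hρ] at h
    have h' := (le_iSup (fun f : {f : Γ → X → ℂ // IsCc f ∧ lipK ℓ k f ≤ 1} =>
      ENNReal.ofReal ‖μ f.1 - ν f.1‖) ⟨_, hmem⟩).trans_lt h
    rw [ENNReal.ofReal_lt_ofReal_iff (by positivity)] at h'
    simp only [map_smul, ← smul_sub, norm_smul, hcn] at h'
    rwa [inv_mul_eq_div, div_lt_div_iff_of_pos_right hN0] at h'
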